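/- There exists a sequence of wirings s_0, s_1, …, s_m for the uniform (7,2)-BDNF game with m ≥ 1 and s_m = s_0, such that for each i < m, the wiring s_{i+1} is obtained from s_i by a single node executing a best-response step that strictly decreases that node's cost. In particular, best-response dynamics for the uniform (7,2)-BDNF game can cycle without reaching a pure Nash equilibrium. -/

import Mathlib

namespace BDNF

variable {V : Type} [DecidableEq V]

/-- `connIn s m v u` : there is a directed path with at most `m` edges from `v`
to `u` in the directed graph defined by the wiring `s`. -/
def connIn (s : V → Finset V) : ℕ → V → V → Prop
  | 0, v, u => v = u
  | m + 1, v, u => v = u ∨ ∃ w ∈ s v, connIn s m w u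

/-- Directed hop distance from `v` to `u`, with disconnection penalty `M`. -/
noncomputable def distW (s : V → Finset V) (M : ℕ) (v u : V) : ℕ := by
  classical exact if h : ∃ m, connIn s m v u then Nat.find h else M

/-- Cost of node `v` in the uniform game: the sum of its distances to all
other nodes. -/
noncomputable def cost [Fintype V] (s : V → Finset V) (M : ℕ) (v : V) : ℕ :=
  ∑ u ∈ Finset.univ.filter (fun u => u ≠ v), distW s M v u

/-- `s` is a wiring with out-degree bound `k`: every node links to at most `k`
other nodes. -/
def IsWiring (k : ℕ) (s : V → Finset V) : Prop :=
  ∀ v, v ∉ s v ∧ (s v).card ≤ k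

/-- `s` is stable (a pure Nash equilibrium) for the uniform game: no node can
strictly decrease its cost by rewiring its own out-links. -/
def Stable [Fintype V] (k M : ℕ) (s : V → Finset V) : Prop :=
  ∀ (v : V) (t : Finset V), v ∉ t → t.card ≤ k →
    cost s M v ≤ cost (Function.update s v t) M v

/-- A wiring is strongly connected if every node has a directed path to every
other node. -/
def StronglyConnected (s : V → Finset V) : Prop :=
  ∀ v u : V, ∃ m : ℕ, connIn s m v u

/-- The reach of node `v`: the number of nodes (including `v` itself) to which
`v` has a directed path. -/
noncomputable def reach (s : V → Finset V) (v : V) : ℕ :=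
  Nat.card {u : V // ∃ m : ℕ, connIn s m v u}

/-- `BRStep k M s v s'` : wiring `s'` is obtained from wiring `s` by node `v`
executing a best-response step, i.e. `v` rewires its out-links to a set of at
most `k` other nodes minimizing its resulting cost (keeping its current links
if they are already optimal), while all other nodes keep their links. -/
def BRStep [Fintype V] (k M : ℕ) (s : V → Finset V) (v : V)
    (s' : V → Finset V) : Prop :=
  (∀ u : V, u ≠ v → s' u = s u) ∧ v ∉ s' v ∧ (s' v).card ≤ k ∧
    (∀ t : Finset V, v ∉ t → t.card ≤ k →
      cost s' M v ≤ cost (Function.update s v t) M v) ∧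
    ((∀ t : Finset V, v ∉ t → t.card ≤ k →
      cost s M v ≤ cost (Function.update s v t) M v) → s' v = s v)

lemma connIn_succ {W : Type} (s : W → Finset W) {m : ℕ} {v u : W} (h : connIn s m v u) :
    connIn s (m + 1) v u := by
  induction m generalizing v with
  | zero => exact Or.inl h
  | succ m ih =>
    rcases h with h | ⟨w, hw, h⟩
    · exact Or.inl h
    · exact Or.inr ⟨w, hw, ih h⟩

lemma connIn_mono {W : Type} (s : W → Finset W) {m n : ℕ} (hmn : m ≤ n) {v u : W}
    (h : connIn s m v u) : connIn s n v u := by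
  induction hmn with
  | refl => exact h
  | step _ ih => exact connIn_succ s ih

lemma distW_le {W : Type} {s : W → Finset W} (M : ℕ) {m : ℕ} {v u : W} (h : connIn s m v u) :
    distW s M v u ≤ m := by
  classical
  unfold distW
  rw [dif_pos ⟨m, h⟩]
  exact Nat.find_min' _ h

lemma connIn_distW {W : Type} {s : W → Finset W} (M : ℕ) {v u : W}
    (h : ∃ m, connIn s m v u) : connIn s (distW s M v u) v u := by
  classical
  unfold distW
  rw [dif_pos h]
  exact Nat.find_spec h

lemma distW_eq_penalty {W : Type} {s : W → Finset W} (M : ℕ) {v u : W}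
    (h : ¬ ∃ m, connIn s m v u) : distW s M v u = M := by
  unfold distW
  rw [dif_neg h]

/-- Bounded reachability `connIn` is decidable. -/
instance connInDecidable (s : V → Finset V) : ∀ m v u, Decidable (connIn s m v u)
  | 0, v, u => inferInstanceAs (Decidable (v = u))
  | m + 1, v, u =>
    haveI : ∀ w, Decidable (connIn s m w u) := fun w => connInDecidable s m w u
    inferInstanceAs (Decidable (v = u ∨ ∃ w ∈ s v, connIn s m w u))

/-- The hop distance from `v` to `u` truncated at `N`. -/
def truncDist (s : V → Finset V) (N : ℕ) (v u : V) : ℕ :=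
  ((Finset.range N).filter fun m => ¬ connIn s m v u).card

/-- The cost of `v` computed from distances truncated at `N`. -/
def truncCost [Fintype V] (s : V → Finset V) (N : ℕ) (v : V) : ℕ :=
  ∑ u ∈ Finset.univ.filter (fun u => u ≠ v), truncDist s N v u

lemma truncDist_le_distW (s : V → Finset V) {M N : ℕ} (hN : N ≤ M) (v u : V) :
    truncDist s N v u ≤ distW s M v u := by
  unfold truncDist
  by_cases h : ∃ m, connIn s m v u
  · rw [← Finset.card_range (distW s M v u)]
    refine Finset.card_le_card fun m hm => ?_
    rw [Finset.mem_filter] at hm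
    rw [Finset.mem_range]
    by_contra hlt
    exact hm.2 (connIn_mono s (not_lt.mp hlt) (connIn_distW M h))
  · rw [distW_eq_penalty M h]
    exact ((Finset.card_filter_le _ _).trans_eq (Finset.card_range N)).trans hN

lemma distW_le_truncDist (s : V → Finset V) (M : ℕ) {N : ℕ} {v u : V}
    (hc : connIn s N v u) : distW s M v u ≤ truncDist s N v u := by
  unfold truncDist
  rw [← Finset.card_range (distW s M v u)]
  refine Finset.card_le_card fun m hm => ?_
  rw [Finset.mem_range] at hm
  rw [Finset.mem_filter, Finset.mem_range]
  exact ⟨hm.trans_le (distW_le M hc), fun h => (distW_le M h).not_gt hm⟩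

lemma truncCost_le_cost [Fintype V] (s : V → Finset V) {M N : ℕ} (hN : N ≤ M) (v : V) :
    truncCost s N v ≤ cost s M v :=
  Finset.sum_le_sum fun u _ => truncDist_le_distW s hN v u

lemma cost_le_truncCost [Fintype V] (s : V → Finset V) (M : ℕ) {N : ℕ} {v : V}
    (hc : ∀ u, connIn s N v u) : cost s M v ≤ truncCost s N v :=
  Finset.sum_le_sum fun u _ => distW_le_truncDist s M (hc u)

/-- A decidable certificate, in terms of truncated costs, that rewiring `v` to `r` is a strictly
improving best-response step. -/
lemma brStep_and_cost_lt_of_truncCost [Fintype V] {k M N : ℕ} (hN : N ≤ M)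
    {s s' : V → Finset V} {v : V} (hs' : s' = Function.update s v (s' v))
    (hv : v ∉ s' v) (hk : (s' v).card ≤ k) (hc : ∀ u, connIn s' N v u)
    (hlt : truncCost s' N v < truncCost s N v)
    (hmin : ∀ t : Finset V, v ∉ t → t.card ≤ k →
      truncCost s' N v ≤ truncCost (Function.update s v t) N v) :
    BRStep k M s v s' ∧ cost s' M v < cost s M v := by
  have hle := cost_le_truncCost s' M hc
  have hcost : cost s' M v < cost s M v :=
    (hle.trans_lt hlt).trans_le (truncCost_le_cost s hN v)
  refine ⟨⟨fun u hu => ?_, hv, hk, fun t ht htk => ?_, fun h => ?_⟩, hcost⟩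
  · rw [hs', Function.update_of_ne hu]
  · exact (hle.trans (hmin t ht htk)).trans (truncCost_le_cost _ hN v)
  · exact absurd (hs' ▸ h (s' v) hv hk) (not_le.mpr hcost)

/-- The wirings of the cycle: only nodes `1` and `4` ever rewire. -/
def cycleWiring (a b : Finset (Fin 7)) : Fin 7 → Finset (Fin 7) :=
  ![{1, 5}, a, {1, 3}, {0, 1}, b, {2, 4}, {1, 4}]

/-- Best-response dynamics for the uniform `(7,2)`-BDNF game can cycle: there
is a sequence of wirings `w 0, w 1, …, w m` with `m ≥ 1` and `w m = w 0` such
that each wiring is obtained from the previous one by a single node executing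
a best-response step that strictly decreases that node's cost. -/
theorem stmt_14 :
    ∀ M : ℕ, 7 ^ 2 < M →
      ∃ m : ℕ, 1 ≤ m ∧
        ∃ w : ℕ → (Fin 7 → Finset (Fin 7)),
          IsWiring 2 (w 0) ∧ w m = w 0 ∧
          ∀ i : ℕ, i < m →
            ∃ v : Fin 7, BRStep 2 M (w i) v (w (i + 1)) ∧
              cost (w (i + 1)) M v < cost (w i) M v := by
  intro M hM
  have hN : 5 ≤ M := by omega
  refine ⟨4, by norm_num, fun i => ![cycleWiring {2, 4} {3, 6}, cycleWiring {0, 4} {3, 6},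
    cycleWiring {0, 4} {5, 6}, cycleWiring {2, 4} {5, 6}] (Fin.ofNat 4 i), ?_, rfl, ?_⟩
  · unfold IsWiring
    decide +kernel
  · intro i hi
    interval_cases i
    · exact ⟨1, brStep_and_cost_lt_of_truncCost hN (by decide +kernel) (by decide +kernel)
        (by decide +kernel) (by decide +kernel) (by decide +kernel) (by decide +kernel)⟩
    · exact ⟨4, brStep_and_cost_lt_of_truncCost hN (by decide +kernel) (by decide +kernel)
        (by decide +kernel) (by decide +kernel) (by decide +kernel) (by decide +kernel)⟩
    · exact ⟨1, brStep_and_cost_lt_of_truncCost hN (by decide +kernel) (by decide +kernel)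
        (by decide +kernel) (by decide +kernel) (by decide +kernel) (by decide +kernel)⟩
    · exact ⟨4, brStep_and_cost_lt_of_truncCost hN (by decide +kernel) (by decide +kernel)
        (by decide +kernel) (by decide +kernel) (by decide +kernel) (by decide +kernel)⟩

end BDNF
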